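/- arXiv:1901.06516 — 6 statements merged into one kernel-verified Lean document; each statement's English description precedes it below -/
import Mathlib

section
/- Let J>0, h∈ℝ, β>0. For each n≥1 let f_n^cw = -(1/(βn)) ln Σ_{σ∈{-1,1}^n} exp(β[(J/n)Σ_{i<j}σ_iσ_j + hΣ_i σ_i]) be the free energy of the Curie-Weiss model. Then lim_{n→∞} f_n^cw = inf_{m̂∈[β(h-J),β(h+J)]} sup_{m∈[-1,1]} f^pot(m,m̂), where f^pot(m,m̂) = -(1/β)ln(2 cosh m̂) - Jm²/2 + (m̂/β - h)m. -/
open Finset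

/-- spin value of a Boolean configuration entry: `true ↦ 1`, `false ↦ -1`. -/
noncomputable def spin (b : Bool) : ℝ := if b then 1 else -1

/-- `∑_{i<j} σ_i σ_j` for a spin configuration on `n` sites. -/
noncomputable def pairSum (n : ℕ) (σ : Fin n → Bool) : ℝ :=
  ∑ i : Fin n, ∑ j ∈ Finset.univ.filter (fun j => i < j), spin (σ i) * spin (σ j)

/-- `∑_i σ_i`. -/
noncomputable def magSum (n : ℕ) (σ : Fin n → Bool) : ℝ :=
  ∑ i : Fin n, spin (σ i)

/-- Curie-Weiss free energy
`f_n^cw = -(1/(βn)) ln Σ_σ exp(β[(J/n)Σ_{i<j}σ_iσ_j + h Σ_i σ_i])`. -/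
noncomputable def fcw (J h β : ℝ) (n : ℕ) : ℝ :=
  -(1 / (β * n)) * Real.log (∑ σ : Fin n → Bool,
    Real.exp (β * (J / n * pairSum n σ + h * magSum n σ)))

/-- The replica-symmetric potential
`f^pot(m, m̂) = -(1/β) ln(2 cosh m̂) - J m²/2 + (m̂/β - h) m`. -/
noncomputable def fpot (J h β m mh : ℝ) : ℝ :=
  -(1 / β) * Real.log (2 * Real.cosh mh) - J * m ^ 2 / 2 + (mh / β - h) * m

/-- The one-variable potential `ln (2 cosh (β (J x + h))) - β J x² / 2`. -/
noncomputable def magnetizationPotential (J h β x : ℝ) : ℝ :=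
  Real.log (2 * Real.cosh (β * (J * x + h))) - β * J * x ^ 2 / 2

/-- The Curie-Weiss partition function. -/
noncomputable def cwPartition (J h β : ℝ) (n : ℕ) : ℝ :=
  ∑ σ : Fin n → Bool, Real.exp (β * (J / n * pairSum n σ + h * magSum n σ))

theorem two_mul_cosh_pos (x : ℝ) : 0 < 2 * Real.cosh x :=
  mul_pos two_pos (Real.cosh_pos x)

theorem spin_mul_self (b : Bool) : spin b * spin b = 1 := by
  cases b <;> simp [spin]

theorem magSum_sq (n : ℕ) (σ : Fin n → Bool) :
    magSum n σ ^ 2 = 2 * pairSum n σ + n := by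
  have swap : ∑ i : Fin n, ∑ j : Fin n, (if j < i then spin (σ i) * spin (σ j) else 0) =
      pairSum n σ := by
    rw [Finset.sum_comm, pairSum]
    refine Finset.sum_congr rfl fun i _ => ?_
    rw [Finset.sum_filter]
    exact Finset.sum_congr rfl fun j _ => by rw [mul_comm]
  have diag : ∑ i : Fin n, ∑ j : Fin n, (if i = j then spin (σ i) * spin (σ j) else 0) = n := by
    simp [spin_mul_self]
  have split : ∀ i j : Fin n, spin (σ i) * spin (σ j) =
      (if i < j then spin (σ i) * spin (σ j) else 0) +
      (if j < i then spin (σ i) * spin (σ j) else 0) +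
      (if i = j then spin (σ i) * spin (σ j) else 0) := by
    intro i j
    rcases lt_trichotomy i j with hij | hij | hij
    · simp [hij, hij.not_gt, hij.ne]
    · simp [hij]
    · simp [hij, hij.not_gt, hij.ne']
  calc magSum n σ ^ 2 = ∑ i : Fin n, ∑ j : Fin n, spin (σ i) * spin (σ j) := by
        rw [sq, magSum, Finset.sum_mul_sum]
    _ = pairSum n σ + pairSum n σ + n := by
        rw [Finset.sum_congr rfl fun i _ => Finset.sum_congr rfl fun j _ => split i j]
        simp only [Finset.sum_add_distrib]
        rw [swap, diag, pairSum]
        simp only [Finset.sum_filter]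
    _ = 2 * pairSum n σ + n := by ring

theorem exists_magSum_eq (n : ℕ) (σ : Fin n → Bool) :
    ∃ a ∈ Finset.range (n + 1), magSum n σ = 2 * (a : ℝ) - n := by
  refine ⟨(Finset.univ.filter fun i => σ i = true).card, ?_, ?_⟩
  · rw [Finset.mem_range, Nat.lt_succ_iff]
    simpa using Finset.card_filter_le (Finset.univ : Finset (Fin n)) fun i => σ i = true
  · have hs : ∀ b : Bool, spin b = 2 * (if b = true then (1 : ℝ) else 0) - 1 := by
      intro b
      cases b <;> norm_num [spin]
    simp only [magSum, hs, Finset.sum_sub_distrib, ← Finset.mul_sum, Finset.sum_boole]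
    simp

theorem sum_exp_mul_magSum (n : ℕ) (c : ℝ) :
    ∑ σ : Fin n → Bool, Real.exp (c * magSum n σ) = (2 * Real.cosh c) ^ n := by
  have hc : 2 * Real.cosh c = ∑ b : Bool, Real.exp (c * spin b) := by
    rw [Fintype.sum_bool, Real.cosh_eq]
    simp [spin]
    ring
  rw [hc, Fintype.sum_pow]
  refine Finset.sum_congr rfl fun σ _ => ?_
  rw [magSum, Finset.mul_sum, Real.exp_sum]

theorem sum_exp_linearized (J h β x : ℝ) (n : ℕ) :
    ∑ σ : Fin n → Bool,
        Real.exp (-(β * J / 2) - n * (β * J * x ^ 2 / 2) + β * (J * x + h) * magSum n σ) =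
      Real.exp (n * magnetizationPotential J h β x - β * J / 2) := by
  simp only [Real.exp_add _ (_ * magSum n _), ← Finset.mul_sum]
  rw [sum_exp_mul_magSum, ← Real.exp_log (two_mul_cosh_pos _), ← Real.exp_nat_mul,
    ← Real.exp_add, magnetizationPotential]
  congr 1
  ring

/-- Completing the square around a trial magnetization `x`. -/
theorem cw_exponent_eq (J h β x : ℝ) {n : ℕ} (hn : n ≠ 0) (σ : Fin n → Bool) :
    β * (J / n * pairSum n σ + h * magSum n σ) =
      -(β * J / 2) - n * (β * J * x ^ 2 / 2) + β * (J * x + h) * magSum n σ +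
        β * J / (2 * n) * (magSum n σ - n * x) ^ 2 := by
  have hn' : (n : ℝ) ≠ 0 := Nat.cast_ne_zero.mpr hn
  have hp : pairSum n σ = (magSum n σ ^ 2 - n) / 2 := by
    rw [magSum_sq]
    ring
  rw [hp]
  field_simp
  ring

theorem exp_le_cwPartition {J β : ℝ} (h : ℝ) (hJ : 0 < J) (hβ : 0 < β) (x : ℝ) {n : ℕ}
    (hn : n ≠ 0) :
    Real.exp (n * magnetizationPotential J h β x - β * J / 2) ≤ cwPartition J h β n := by
  rw [← sum_exp_linearized, cwPartition]
  refine Finset.sum_le_sum fun σ _ => Real.exp_le_exp.mpr ?_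
  rw [cw_exponent_eq J h β x hn]
  exact le_add_of_nonneg_right (by positivity)

theorem cwPartition_le (J h β P : ℝ) {n : ℕ} (hn : n ≠ 0)
    (hP : ∀ x ∈ Set.Icc (-1 : ℝ) 1, magnetizationPotential J h β x ≤ P) :
    cwPartition J h β n ≤ (n + 1) * Real.exp (n * P - β * J / 2) := by
  have hn' : (0 : ℝ) < n := Nat.cast_pos.mpr (Nat.pos_of_ne_zero hn)
  let x : ℕ → ℝ := fun a => (2 * (a : ℝ) - n) / n
  calc cwPartition J h β n
      ≤ ∑ σ : Fin n → Bool, ∑ a ∈ Finset.range (n + 1), Real.exp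
          (-(β * J / 2) - n * (β * J * x a ^ 2 / 2) + β * (J * x a + h) * magSum n σ) := by
        refine Finset.sum_le_sum fun σ _ => ?_
        obtain ⟨a, ha, hM⟩ := exists_magSum_eq n σ
        have hx : magSum n σ - n * x a = 0 := by
          rw [hM, mul_div_cancel₀ _ hn'.ne', sub_self]
        rw [cw_exponent_eq J h β (x a) hn, hx, zero_pow two_ne_zero, mul_zero, add_zero]
        exact Finset.single_le_sum (f := fun a => Real.exp
          (-(β * J / 2) - n * (β * J * x a ^ 2 / 2) + β * (J * x a + h) * magSum n σ))
          (fun _ _ => (Real.exp_pos _).le) ha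
    _ = ∑ a ∈ Finset.range (n + 1),
          Real.exp (n * magnetizationPotential J h β (x a) - β * J / 2) := by
        rw [Finset.sum_comm]
        exact Finset.sum_congr rfl fun a _ => sum_exp_linearized J h β (x a) n
    _ ≤ ∑ _a ∈ Finset.range (n + 1), Real.exp (n * P - β * J / 2) := by
        refine Finset.sum_le_sum fun a ha => Real.exp_le_exp.mpr ?_
        have ha' : (a : ℝ) ≤ n := by
          exact_mod_cast Nat.lt_succ_iff.mp (Finset.mem_range.mp ha)
        have ha0 : (0 : ℝ) ≤ a := a.cast_nonneg
        have hxa : x a ∈ Set.Icc (-1 : ℝ) 1 :=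
          ⟨(le_div_iff₀ hn').mpr (by linarith), (div_le_iff₀ hn').mpr (by linarith)⟩
        gcongr
        exact hP _ hxa
    _ = (n + 1) * Real.exp (n * P - β * J / 2) := by simp

theorem tendsto_log_succ_div : Filter.Tendsto (fun n : ℕ => Real.log (n + 1) / n)
    Filter.atTop (nhds 0) := by
  have hlog : Filter.Tendsto (fun n : ℕ => Real.log ((n + 1 : ℕ) : ℝ) / ((n + 1 : ℕ) : ℝ))
      Filter.atTop (nhds 0) :=
    (Real.isLittleO_log_id_atTop.tendsto_div_nhds_zero.comp
      tendsto_natCast_atTop_atTop).comp (Filter.tendsto_add_atTop_nat 1)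
  have hratio : Filter.Tendsto (fun n : ℕ => 1 + 1 / (n : ℝ)) Filter.atTop (nhds 1) := by
    simpa using (tendsto_one_div_atTop_nhds_zero_nat (𝕜 := ℝ)).const_add 1
  have hprod := hlog.mul hratio
  rw [zero_mul] at hprod
  refine hprod.congr' ?_
  filter_upwards [Filter.eventually_ne_atTop 0] with n hn
  have hn' : (n : ℝ) ≠ 0 := Nat.cast_ne_zero.mpr hn
  have hn1 : (n : ℝ) + 1 ≠ 0 := by positivity
  push_cast
  field_simp

theorem tendsto_log_cwPartition_div {J h β x₀ : ℝ} (hJ : 0 < J) (hβ : 0 < β)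
    (hmax : ∀ x ∈ Set.Icc (-1 : ℝ) 1,
      magnetizationPotential J h β x ≤ magnetizationPotential J h β x₀) :
    Filter.Tendsto (fun n : ℕ => Real.log (cwPartition J h β n) / n) Filter.atTop
      (nhds (magnetizationPotential J h β x₀)) := by
  set P := magnetizationPotential J h β x₀
  have hconst : Filter.Tendsto (fun n : ℕ => β * J / 2 / (n : ℝ)) Filter.atTop (nhds 0) :=
    tendsto_const_div_atTop_nhds_zero_nat _
  have hlower : Filter.Tendsto (fun n : ℕ => P - β * J / 2 / (n : ℝ)) Filter.atTop (nhds P) := by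
    simpa using hconst.const_sub P
  have hupper : Filter.Tendsto (fun n : ℕ => Real.log (n + 1) / n + (P - β * J / 2 / (n : ℝ)))
      Filter.atTop (nhds P) := by
    simpa using tendsto_log_succ_div.add hlower
  refine tendsto_of_tendsto_of_tendsto_of_le_of_le' hlower hupper ?_ ?_
  · filter_upwards [Filter.eventually_ne_atTop 0] with n hn
    have hn' : (0 : ℝ) < n := Nat.cast_pos.mpr (Nat.pos_of_ne_zero hn)
    have hlog := Real.log_le_log (Real.exp_pos _) (exp_le_cwPartition h hJ hβ x₀ hn)
    rw [Real.log_exp] at hlog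
    calc P - β * J / 2 / (n : ℝ) = (n * P - β * J / 2) / n := by field_simp
      _ ≤ _ := by gcongr
  · filter_upwards [Filter.eventually_ne_atTop 0] with n hn
    have hn' : (0 : ℝ) < n := Nat.cast_pos.mpr (Nat.pos_of_ne_zero hn)
    have hlog := Real.log_le_log
      ((Real.exp_pos _).trans_le (exp_le_cwPartition h hJ hβ x₀ hn))
      (cwPartition_le J h β P hn hmax)
    rw [Real.log_mul (by positivity) (Real.exp_ne_zero _), Real.log_exp] at hlog
    calc Real.log (cwPartition J h β n) / n
        ≤ (Real.log (n + 1) + (n * P - β * J / 2)) / n := by gcongr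
      _ = _ := by field_simp

theorem continuous_magnetizationPotential (J h β : ℝ) :
    Continuous (magnetizationPotential J h β) := by
  unfold magnetizationPotential
  refine Continuous.sub (Continuous.log ?_ fun x => (two_mul_cosh_pos _).ne') (by fun_prop)
  exact continuous_const.mul (Real.continuous_cosh.comp (by fun_prop))

theorem sSup_fpot {J β : ℝ} (h : ℝ) (hJ : 0 < J) (hβ : 0 < β) {x : ℝ}
    (hx : x ∈ Set.Icc (-1 : ℝ) 1) :
    sSup ((fun m => fpot J h β m (β * (J * x + h))) '' Set.Icc (-1 : ℝ) 1) =
      -(1 / β) * magnetizationPotential J h β x := by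
  have key : ∀ m, fpot J h β m (β * (J * x + h)) =
      -(1 / β) * magnetizationPotential J h β x - J / 2 * (m - x) ^ 2 := by
    intro m
    rw [fpot, magnetizationPotential]
    field_simp
    ring
  refine IsGreatest.csSup_eq ⟨⟨x, hx, by simp [key]⟩, ?_⟩
  rintro _ ⟨m, -, rfl⟩
  simp only [key]
  exact sub_le_self _ (by positivity)

theorem sInf_sSup_fpot {J h β x₀ : ℝ} (hJ : 0 < J) (hβ : 0 < β)
    (hx₀ : x₀ ∈ Set.Icc (-1 : ℝ) 1)
    (hmax : ∀ x ∈ Set.Icc (-1 : ℝ) 1,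
      magnetizationPotential J h β x ≤ magnetizationPotential J h β x₀) :
    sInf ((fun mh => sSup ((fun m => fpot J h β m mh) '' Set.Icc (-1 : ℝ) 1))
        '' Set.Icc (β * (h - J)) (β * (h + J))) =
      -(1 / β) * magnetizationPotential J h β x₀ := by
  refine IsLeast.csInf_eq ⟨⟨β * (J * x₀ + h), ⟨?_, ?_⟩, sSup_fpot h hJ hβ hx₀⟩, ?_⟩
  · refine mul_le_mul_of_nonneg_left ?_ hβ.le
    nlinarith [hx₀.1]
  · refine mul_le_mul_of_nonneg_left ?_ hβ.le
    nlinarith [hx₀.2]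
  · rintro _ ⟨mh, hmh, rfl⟩
    have hlo : h - J ≤ mh / β := (le_div_iff₀' hβ).mpr hmh.1
    have hhi : mh / β ≤ h + J := (div_le_iff₀' hβ).mpr hmh.2
    have hx : (mh / β - h) / J ∈ Set.Icc (-1 : ℝ) 1 :=
      ⟨(le_div_iff₀ hJ).mpr (by linarith), (div_le_iff₀ hJ).mpr (by linarith)⟩
    have hmh' : mh = β * (J * ((mh / β - h) / J) + h) := by
      field_simp
      ring
    rw [hmh']
    change _ ≤ sSup _
    rw [sSup_fpot h hJ hβ hx]
    exact mul_le_mul_of_nonpos_left (hmax _ hx) (by simpa using hβ.le)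

/-- The adaptive-interpolation solution of the Curie-Weiss model:
`lim_{n→∞} f_n^cw = inf_{m̂ ∈ [β(h-J), β(h+J)]} sup_{m ∈ [-1,1]} f^pot(m, m̂)`. -/
theorem curieWeiss_replica_formula (J h β : ℝ) (hJ : 0 < J) (hβ : 0 < β) :
    Filter.Tendsto (fun n : ℕ => fcw J h β n) Filter.atTop
      (nhds (sInf ((fun mh => sSup ((fun m => fpot J h β m mh) '' Set.Icc (-1 : ℝ) 1))
        '' Set.Icc (β * (h - J)) (β * (h + J))))) := by
  obtain ⟨x₀, hx₀, hmax⟩ := isCompact_Icc.exists_isMaxOn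
    (Set.nonempty_Icc.mpr (by norm_num : (-1 : ℝ) ≤ 1))
    (continuous_magnetizationPotential J h β).continuousOn
  have hmax' := isMaxOn_iff.mp hmax
  rw [sInf_sSup_fpot hJ hβ hx₀ hmax']
  refine ((tendsto_log_cwPartition_div hJ hβ hmax').const_mul (-(1 / β))).congr fun n => ?_
  rw [fcw, cwPartition, one_div, one_div, mul_inv]
  ring
end

section
/- Let J>0, h∈ℝ, β>0, A=[β(h-J),β(h+J)], and f^pot(m,m̂) = -(1/β)ln(2 cosh m̂) - Jm²/2 + (m̂/β - h)m. Then inf_{m̂∈A} sup_{m∈[-1,1]} f^pot(m,m̂) = inf_{m̂∈A} { (m̂/β - h)²/(2J) - (1/β)ln(2 cosh m̂) } = inf_{m∈[-1,1]} { Jm²/2 - (1/β)ln(2 cosh(β(Jm+h))) }. -/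
theorem isGreatest_fpot_image {J h β mh : ℝ} (hJ : 0 < J) (hβ : 0 < β)
    (hmh : mh ∈ Set.Icc (β * (h - J)) (β * (h + J))) :
    IsGreatest ((fun m => fpot J h β m mh) '' Set.Icc (-1 : ℝ) 1)
      ((mh / β - h) ^ 2 / (2 * J) - (1 / β) * Real.log (2 * Real.cosh mh)) := by
  have hlo : h - J ≤ mh / β := by
    rw [le_div_iff₀ hβ]
    linarith [hmh.1]
  have hhi : mh / β ≤ h + J := by
    rw [div_le_iff₀ hβ]
    linarith [hmh.2]
  have key : ∀ m, fpot J h β m mh = (mh / β - h) ^ 2 / (2 * J)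
      - (1 / β) * Real.log (2 * Real.cosh mh) - J / 2 * (m - (mh / β - h) / J) ^ 2 := by
    intro m
    unfold fpot
    generalize mh / β = x
    field_simp
    ring
  refine ⟨⟨(mh / β - h) / J, ⟨?_, ?_⟩, ?_⟩, ?_⟩
  · rw [le_div_iff₀ hJ]
    linarith
  · rw [div_le_iff₀ hJ]
    linarith
  · simp only [key, sub_self]
    ring
  · rintro _ ⟨m, -, rfl⟩
    simp only [key]
    have : 0 ≤ J / 2 * (m - (mh / β - h) / J) ^ 2 := by positivity
    linarith

theorem image_affine_Icc_neg_one_one {J β : ℝ} (h : ℝ) (hJ : 0 < J) (hβ : 0 < β) :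
    (fun m => β * (J * m + h)) '' Set.Icc (-1 : ℝ) 1
      = Set.Icc (β * (h - J)) (β * (h + J)) := by
  have key := Set.image_affine_Icc' (mul_pos hβ hJ) (β * h) (-1) 1
  simp only [show ∀ m, β * (J * m + h) = β * J * m + β * h from fun m => by ring]
  rw [key]
  congr 1 <;> ring

/-- Explicit maximization over `m` in the Curie-Weiss replica-symmetric variational
formula, and re-parametrization `m̂ = β(Jm + h)`:
`inf_{m̂∈A} sup_{m∈[-1,1]} f^pot(m,m̂)
  = inf_{m̂∈A} { (m̂/β - h)²/(2J) - (1/β) ln(2 cosh m̂) }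
  = inf_{m∈[-1,1]} { Jm²/2 - (1/β) ln(2 cosh(β(Jm + h))) }`,
where `A = [β(h-J), β(h+J)]`. -/
theorem curieWeiss_potential_simplification (J h β : ℝ) (hJ : 0 < J) (hβ : 0 < β) :
    sInf ((fun mh => sSup ((fun m => fpot J h β m mh) '' Set.Icc (-1 : ℝ) 1))
        '' Set.Icc (β * (h - J)) (β * (h + J)))
      = sInf ((fun mh => (mh / β - h) ^ 2 / (2 * J) - (1 / β) * Real.log (2 * Real.cosh mh))
        '' Set.Icc (β * (h - J)) (β * (h + J)))
    ∧ sInf ((fun mh => (mh / β - h) ^ 2 / (2 * J) - (1 / β) * Real.log (2 * Real.cosh mh))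
        '' Set.Icc (β * (h - J)) (β * (h + J)))
      = sInf ((fun m => J * m ^ 2 / 2 - (1 / β) * Real.log (2 * Real.cosh (β * (J * m + h))))
        '' Set.Icc (-1 : ℝ) 1) := by
  constructor
  · congr 1
    exact Set.image_congr fun mh hmh => (isGreatest_fpot_image hJ hβ hmh).csSup_eq
  · rw [← image_affine_Icc_neg_one_one h hJ hβ, Set.image_image]
    congr 1
    refine Set.image_congr fun m _ => ?_
    congr 1
    field_simp
    ring
end

section
/- Let J>0, h∈ℝ, β>0, A=[β(h-J),β(h+J)], and f^pot(m,m̂) = -(1/β)ln(2 cosh m̂) - Jm²/2 + (m̂/β - h)m. Then the minimax equals the maximin: inf_{m̂∈A} sup_{m∈[-1,1]} f^pot(m,m̂) = inf_{m∈[-1,1]} sup_{m̂∈A} f^pot(m,m̂). -/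
/-- `log ∘ cosh` lies above its tangent line at `x`. -/
theorem log_cosh_add_tanh_mul_le (x y : ℝ) :
    Real.log (2 * Real.cosh x) + Real.tanh x * (y - x) ≤ Real.log (2 * Real.cosh y) := by
  have hx := Real.cosh_pos x
  have hp : 0 ≤ Real.exp x / (2 * Real.cosh x) := by positivity
  have hq : 0 ≤ Real.exp (-x) / (2 * Real.cosh x) := by positivity
  have hpq : Real.exp x / (2 * Real.cosh x) + Real.exp (-x) / (2 * Real.cosh x) = 1 := by
    rw [← add_div, div_eq_one_iff_eq (by positivity), Real.cosh_eq]
    ring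
  have hconv := convexOn_exp.2 (Set.mem_univ (y - x)) (Set.mem_univ (-(y - x))) hp hq hpq
  simp only [smul_eq_mul] at hconv
  have hmean : Real.exp x / (2 * Real.cosh x) * (y - x)
      + Real.exp (-x) / (2 * Real.cosh x) * -(y - x) = Real.tanh x * (y - x) := by
    rw [Real.tanh_eq_sinh_div_cosh, Real.sinh_eq]
    field_simp
    ring
  have hratio : Real.exp x / (2 * Real.cosh x) * Real.exp (y - x)
      + Real.exp (-x) / (2 * Real.cosh x) * Real.exp (-(y - x))
      = 2 * Real.cosh y / (2 * Real.cosh x) := by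
    rw [div_mul_eq_mul_div, div_mul_eq_mul_div, ← add_div, ← Real.exp_add, ← Real.exp_add,
      show x + (y - x) = y by ring, show -x + -(y - x) = -y by ring, Real.cosh_eq y]
    ring
  rw [hmean, hratio, le_div_iff₀ (by positivity)] at hconv
  rw [Real.le_log_iff_exp_le (mul_pos two_pos (Real.cosh_pos y)), Real.exp_add,
    Real.exp_log (by positivity)]
  linarith

theorem continuous_fpot (J h β : ℝ) : Continuous fun p : ℝ × ℝ => fpot J h β p.1 p.2 := by
  have hlog : Continuous fun p : ℝ × ℝ => Real.log (2 * Real.cosh p.2) :=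
    (continuous_const.mul (Real.continuous_cosh.comp continuous_snd)).log
      fun p => (mul_pos two_pos (Real.cosh_pos p.2)).ne'
  unfold fpot
  fun_prop

/-- For fixed `m̂ = β (h + J m)`, the potential is maximal in its first argument at `m`. -/
theorem fpot_le_fpot_left {J β : ℝ} (hJ : 0 < J) (hβ : 0 < β) (h m n : ℝ) :
    fpot J h β n (β * (h + J * m)) ≤ fpot J h β m (β * (h + J * m)) := by
  unfold fpot
  rw [mul_div_cancel_left₀ _ hβ.ne']
  nlinarith [mul_nonneg hJ.le (sq_nonneg (m - n))]

/-- For fixed `m = tanh m̂`, the potential is maximal in its second argument at `m̂`. -/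
theorem fpot_le_fpot_right {β : ℝ} (hβ : 0 < β) (J h mh mh' : ℝ) :
    fpot J h β (Real.tanh mh) mh' ≤ fpot J h β (Real.tanh mh) mh := by
  have key := mul_le_mul_of_nonneg_left (log_cosh_add_tanh_mul_le mh mh') (one_div_pos.2 hβ).le
  unfold fpot
  simp only [div_eq_mul_inv] at key ⊢
  linarith

/-- If for every `x ∈ s` some section `f · y` with `y ∈ t` attains its maximum over `s` at `x`,
then `inf_t sup_s f ≤ inf_s sup_t f`. -/
theorem sInf_sSup_le_sInf_sSup {f : ℝ → ℝ → ℝ} {s t : Set ℝ} (hs : IsCompact s)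
    (ht : IsCompact t) (hne : s.Nonempty)
    (hf : Continuous fun p : ℝ × ℝ => f p.1 p.2)
    (hmax : ∀ x ∈ s, ∃ y ∈ t, ∀ x' ∈ s, f x' y ≤ f x y) :
    sInf ((fun y => sSup ((fun x => f x y) '' s)) '' t)
      ≤ sInf ((fun x => sSup ((fun y => f x y) '' t)) '' s) := by
  obtain ⟨x₀, hx₀⟩ := hne
  have hleft : ∀ y, BddAbove ((fun x => f x y) '' s) := fun y =>
    hs.bddAbove_image (hf.comp (by fun_prop : Continuous fun x : ℝ => (x, y))).continuousOn
  have hright : ∀ x, BddAbove ((fun y => f x y) '' t) := fun x =>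
    ht.bddAbove_image (hf.comp (by fun_prop : Continuous fun y : ℝ => (x, y))).continuousOn
  have hbelow : BddBelow ((fun y => sSup ((fun x => f x y) '' s)) '' t) := by
    obtain ⟨b, hb⟩ := ht.bddBelow_image
      (hf.comp (by fun_prop : Continuous fun y : ℝ => (x₀, y))).continuousOn
    refine ⟨b, ?_⟩
    rintro _ ⟨y, hy, rfl⟩
    exact (hb ⟨y, hy, rfl⟩).trans (le_csSup (hleft y) ⟨x₀, hx₀, rfl⟩)
  refine le_csInf (Set.Nonempty.image _ ⟨x₀, hx₀⟩) ?_
  rintro _ ⟨x, hx, rfl⟩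
  obtain ⟨y, hy, hxy⟩ := hmax x hx
  refine csInf_le_of_le hbelow ⟨y, hy, rfl⟩ (csSup_le (Set.Nonempty.image _ ⟨x₀, hx₀⟩) ?_)
  rintro _ ⟨x', hx', rfl⟩
  exact (hxy x' hx').trans (le_csSup (hright x) ⟨y, hy, rfl⟩)


/-- The minimax equals the maximin for the Curie-Weiss replica-symmetric potential:
`inf_{m̂∈A} sup_{m∈[-1,1]} f^pot(m,m̂) = inf_{m∈[-1,1]} sup_{m̂∈A} f^pot(m,m̂)`,
where `A = [β(h-J), β(h+J)]`. -/
theorem curieWeiss_minimax_eq_maximin (J h β : ℝ) (hJ : 0 < J) (hβ : 0 < β) :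
    sInf ((fun mh => sSup ((fun m => fpot J h β m mh) '' Set.Icc (-1 : ℝ) 1))
        '' Set.Icc (β * (h - J)) (β * (h + J)))
      = sInf ((fun m => sSup ((fun mh => fpot J h β m mh)
          '' Set.Icc (β * (h - J)) (β * (h + J)))) '' Set.Icc (-1 : ℝ) 1) := by
  have hJβ : 0 < β * J := mul_pos hβ hJ
  have hs : (Set.Icc (-1 : ℝ) 1).Nonempty := ⟨0, by norm_num, by norm_num⟩
  have ht : (Set.Icc (β * (h - J)) (β * (h + J))).Nonempty :=
    Set.nonempty_Icc.2 (by nlinarith)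
  refine le_antisymm ?_ ?_
  · refine sInf_sSup_le_sInf_sSup (f := fpot J h β) isCompact_Icc isCompact_Icc hs
      (continuous_fpot J h β) fun m hm => ⟨β * (h + J * m), ?_, fun n _ =>
        fpot_le_fpot_left hJ hβ h m n⟩
    constructor <;> nlinarith [hm.1, hm.2]
  · have hcont := (continuous_fpot J h β).comp continuous_swap
    exact sInf_sSup_le_sInf_sSup (f := fun mh m => fpot J h β m mh) isCompact_Icc isCompact_Icc
      ht hcont fun mh _ => ⟨Real.tanh mh,
        ⟨(Real.neg_one_lt_tanh mh).le, (Real.tanh_lt_one mh).le⟩, fun mh' _ =>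
          fpot_le_fpot_right hβ J h mh mh'⟩
end

section
/- Let J>0, h∈ℝ, β>0, A=[β(h-J),β(h+J)], and f^pot(m,m̂) = -(1/β)ln(2 cosh m̂) - Jm²/2 + (m̂/β - h)m. Then inf_{m̂∈A} sup_{m∈[-1,1]} f^pot(m,m̂) = inf_{m∈[-1,1]} { -Jm²/2 - hm - (1/β) h₂(m) }, where h₂(m) = -((1+m)/2)ln((1+m)/2) - ((1-m)/2)ln((1-m)/2) is the binary entropy function. -/
/-- The binary entropy function
`h₂(m) = -((1+m)/2) ln((1+m)/2) - ((1-m)/2) ln((1-m)/2)`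
(with the convention `0 ln 0 = 0`, which is `Real.log 0 = 0` in Lean). -/
noncomputable def binEnt (m : ℝ) : ℝ :=
  -((1 + m) / 2) * Real.log ((1 + m) / 2) - ((1 - m) / 2) * Real.log ((1 - m) / 2)

theorem mul_log_sub_log_le_sub {p a : ℝ} (hp : 0 ≤ p) (ha : 0 < a) :
    p * (Real.log a - Real.log p) ≤ a - p := by
  rcases hp.eq_or_lt with rfl | hp
  · simpa using ha.le
  · rw [← Real.log_div ha.ne' hp.ne']
    calc p * Real.log (a / p) ≤ p * (a / p - 1) :=
          mul_le_mul_of_nonneg_left (Real.log_le_sub_one_of_pos (div_pos ha hp)) hp.le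
      _ = a - p := by field_simp

theorem log_exp_div_two_mul_cosh (x y : ℝ) :
    Real.log (Real.exp y / (2 * Real.cosh x)) = y - Real.log (2 * Real.cosh x) := by
  have := Real.cosh_pos x
  rw [Real.log_div (Real.exp_pos y).ne' (by positivity), Real.log_exp]

theorem exp_div_add_exp_neg_div_two_mul_cosh (x : ℝ) :
    Real.exp x / (2 * Real.cosh x) + Real.exp (-x) / (2 * Real.cosh x) = 1 := by
  have := Real.cosh_pos x
  rw [← add_div, div_eq_one_iff_eq (by positivity), Real.cosh_eq]
  ring

/-- The Gibbs variational inequality for a single spin. -/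
theorem binEnt_add_mul_le_log_two_mul_cosh {m : ℝ} (hm : m ∈ Set.Icc (-1 : ℝ) 1) (x : ℝ) :
    binEnt m + x * m ≤ Real.log (2 * Real.cosh x) := by
  have hc := Real.cosh_pos x
  have hplus := mul_log_sub_log_le_sub (p := (1 + m) / 2) (a := Real.exp x / (2 * Real.cosh x))
    (by linarith [hm.1]) (by positivity)
  have hminus := mul_log_sub_log_le_sub (p := (1 - m) / 2)
    (a := Real.exp (-x) / (2 * Real.cosh x)) (by linarith [hm.2]) (by positivity)
  rw [log_exp_div_two_mul_cosh] at hplus hminus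
  have hsum := exp_div_add_exp_neg_div_two_mul_cosh x
  unfold binEnt
  linarith

/-- Equality in the Gibbs variational inequality is attained at `m = tanh x`. -/
theorem binEnt_tanh_add_mul (x : ℝ) :
    binEnt (Real.tanh x) + x * Real.tanh x = Real.log (2 * Real.cosh x) := by
  have hc := Real.cosh_pos x
  have hplus : (1 + Real.tanh x) / 2 = Real.exp x / (2 * Real.cosh x) := by
    rw [Real.tanh_eq_sinh_div_cosh, ← Real.cosh_add_sinh]
    field_simp
  have hminus : (1 - Real.tanh x) / 2 = Real.exp (-x) / (2 * Real.cosh x) := by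
    rw [Real.tanh_eq_sinh_div_cosh, ← Real.cosh_sub_sinh]
    field_simp
  have hplus_log := log_exp_div_two_mul_cosh x x
  have hminus_log := log_exp_div_two_mul_cosh x (-x)
  rw [← hplus] at hplus_log
  rw [← hminus] at hminus_log
  unfold binEnt
  rw [hplus_log, hminus_log]
  ring

theorem tanh_mem_Icc (x : ℝ) : Real.tanh x ∈ Set.Icc (-1 : ℝ) 1 :=
  ⟨(Real.neg_one_lt_tanh x).le, (Real.tanh_lt_one x).le⟩

/-- For `m̂ = β (h + J y)` with `y ∈ [-1, 1]`, the potential is maximal at `m = y`. -/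
theorem sSup_fpot_image_Icc {J β y : ℝ} (h : ℝ) (hJ : 0 < J) (hβ : 0 < β)
    (hy : y ∈ Set.Icc (-1 : ℝ) 1) :
    sSup ((fun m => fpot J h β m (β * (h + J * y))) '' Set.Icc (-1 : ℝ) 1)
      = J * y ^ 2 / 2 - (1 / β) * Real.log (2 * Real.cosh (β * (h + J * y))) := by
  have hdiv : β * (h + J * y) / β = h + J * y := mul_div_cancel_left₀ _ hβ.ne'
  refine IsGreatest.csSup_eq ⟨⟨y, hy, ?_⟩, ?_⟩
  · simp only [fpot, hdiv]
    ring
  · rintro _ ⟨m, -, rfl⟩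
    simp only [fpot, hdiv]
    nlinarith [mul_nonneg hJ.le (sq_nonneg (m - y))]

theorem image_Icc_mul_add_mul {J β : ℝ} (h : ℝ) (hJ : 0 < J) (hβ : 0 < β) :
    (fun y => β * (h + J * y)) '' Set.Icc (-1 : ℝ) 1
      = Set.Icc (β * (h - J)) (β * (h + J)) := by
  have hβJ : 0 < β * J := mul_pos hβ hJ
  have heq : (fun y => β * (h + J * y)) = fun y => β * J * y + β * h := by
    funext y
    ring
  rw [heq, Set.image_affine_Icc' hβJ]
  congr 1 <;> ring

/-- The Curie-Weiss minimax formula equals the classical entropy variational formula: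
`inf_{m̂∈A} sup_{m∈[-1,1]} f^pot(m,m̂) = inf_{m∈[-1,1]} { -Jm²/2 - hm - (1/β) h₂(m) }`,
where `A = [β(h-J), β(h+J)]`. -/
theorem curieWeiss_entropy_formula (J h β : ℝ) (hJ : 0 < J) (hβ : 0 < β) :
    sInf ((fun mh => sSup ((fun m => fpot J h β m mh) '' Set.Icc (-1 : ℝ) 1))
        '' Set.Icc (β * (h - J)) (β * (h + J)))
      = sInf ((fun m => -(J * m ^ 2) / 2 - h * m - (1 / β) * binEnt m)
          '' Set.Icc (-1 : ℝ) 1) := by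
  rw [← image_Icc_mul_add_mul h hJ hβ, Set.image_image,
    Set.image_congr fun y hy => sSup_fpot_image_Icc h hJ hβ hy]
  set φ : ℝ → ℝ := fun y =>
    J * y ^ 2 / 2 - (1 / β) * Real.log (2 * Real.cosh (β * (h + J * y))) with hφ
  set ψ : ℝ → ℝ := fun m => -(J * m ^ 2) / 2 - h * m - (1 / β) * binEnt m with hψ
  have hφ_le : ∀ m ∈ Set.Icc (-1 : ℝ) 1, φ m ≤ ψ m := fun m hm => by
    have hgibbs := mul_le_mul_of_nonneg_left
      (binEnt_add_mul_le_log_two_mul_cosh hm (β * (h + J * m))) (one_div_pos.2 hβ).le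
    have hexpand : 1 / β * (binEnt m + β * (h + J * m) * m)
        = 1 / β * binEnt m + (h + J * m) * m := by field_simp
    simp only [hφ, hψ]
    linarith
  have hψ_le : ∀ y, ψ (Real.tanh (β * (h + J * y))) ≤ φ y := fun y => by
    set t := Real.tanh (β * (h + J * y)) with ht
    have hexpand : 1 / β * (binEnt t + β * (h + J * y) * t)
        = 1 / β * binEnt t + (h + J * y) * t := by field_simp
    simp only [hφ, hψ, ← binEnt_tanh_add_mul, ← ht, hexpand]
    nlinarith [mul_nonneg hJ.le (sq_nonneg (y - t))]
  have hψ_bdd : BddBelow (ψ '' Set.Icc (-1 : ℝ) 1) := by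
    refine ⟨-J / 2 - |h| - 1 / β * Real.log 2, ?_⟩
    rintro _ ⟨m, hm, rfl⟩
    have hent : binEnt m ≤ Real.log 2 := by
      simpa using binEnt_add_mul_le_log_two_mul_cosh hm 0
    have hent_div := mul_le_mul_of_nonneg_left hent (one_div_pos.2 hβ).le
    have hfield : h * m ≤ |h| := (le_abs_self _).trans <| by
      rw [abs_mul]
      exact mul_le_of_le_one_right (abs_nonneg h) (abs_le.2 hm)
    have hsq : J * m ^ 2 ≤ J :=
      mul_le_of_le_one_right hJ.le ((sq_le_one_iff_abs_le_one m).2 (abs_le.2 hm))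
    simp only [hψ]
    linarith
  have hφ_bdd : BddBelow (φ '' Set.Icc (-1 : ℝ) 1) := by
    obtain ⟨b, hb⟩ := hψ_bdd
    refine ⟨b, ?_⟩
    rintro _ ⟨y, -, rfl⟩
    exact (hb ⟨_, tanh_mem_Icc _, rfl⟩).trans (hψ_le y)
  have hne : (Set.Icc (-1 : ℝ) 1).Nonempty := ⟨0, by norm_num⟩
  refine le_antisymm (le_csInf (hne.image ψ) ?_) (le_csInf (hne.image φ) ?_)
  · rintro _ ⟨m, hm, rfl⟩
    exact (csInf_le hφ_bdd ⟨m, hm, rfl⟩).trans (hφ_le m hm)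
  · rintro _ ⟨y, -, rfl⟩
    exact (csInf_le hψ_bdd ⟨_, tanh_mem_Icc _, rfl⟩).trans (hψ_le y)
end

section
/- Fix J>0, h∈ℝ, β>0, n≥1, t∈[0,1], and s_n∈(0,1/2]. For ε∈[s_n,2s_n] let R_ε(t)∈ℝ, and assume the map ε↦R_ε(t) is regular, i.e. it is a C¹ diffeomorphism onto its image with Jacobian ∂_ε R_ε(t) ≥ 1. With the interpolating Gibbs bracket ⟨-⟩_{t,ε} associated to the Hamiltonian H_{t,ε}(σ) = (1-t)[-(J/n)Σ_{i<j}σ_iσ_j - hΣσ_i] - (R_ε(t)/β)Σσ_i and magnetization M = (1/n)Σσ_i, one has (1/s_n)∫_{s_n}^{2s_n} dε ⟨(M - ⟨M⟩_{t,ε})²⟩_{t,ε} ≤ 2/(n s_n). -/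
open Finset

/-- Interpolating Curie-Weiss Hamiltonian
`H_{t,R}(σ) = (1-t)[-(J/n)Σ_{i<j}σ_iσ_j - hΣ_i σ_i] - (R/β)Σ_i σ_i`. -/
noncomputable def Hcw (J h β : ℝ) (n : ℕ) (t R : ℝ) (σ : Fin n → Bool) : ℝ :=
  (1 - t) * (-(J / n) * pairSum n σ - h * magSum n σ) - (R / β) * magSum n σ

/-- Gibbs expectation `⟨A⟩_{t,R}` for the interpolating Curie-Weiss model. -/
noncomputable def gibbsCW (J h β : ℝ) (n : ℕ) (t R : ℝ) (A : (Fin n → Bool) → ℝ) : ℝ :=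
  (∑ σ : Fin n → Bool, A σ * Real.exp (-(β * Hcw J h β n t R σ))) /
  (∑ σ : Fin n → Bool, Real.exp (-(β * Hcw J h β n t R σ)))

/-- Magnetization `M(σ) = (1/n) Σ_i σ_i`. -/
noncomputable def mag (n : ℕ) (σ : Fin n → Bool) : ℝ := magSum n σ / n

theorem partition_pos (J h β : ℝ) (n : ℕ) (t R : ℝ) :
    0 < ∑ σ : Fin n → Bool, Real.exp (-(β * Hcw J h β n t R σ)) :=
  Finset.sum_pos (fun _ _ => Real.exp_pos _) Finset.univ_nonempty

theorem magSum_eq_mul_mag {n : ℕ} (hn : 1 ≤ n) (σ : Fin n → Bool) :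
    magSum n σ = n * mag n σ := by
  have : (n : ℝ) ≠ 0 := by positivity
  unfold mag
  field_simp

theorem abs_magSum_le (n : ℕ) (σ : Fin n → Bool) : |magSum n σ| ≤ n := by
  unfold magSum
  refine (Finset.abs_sum_le_sum_abs _ _).trans ?_
  have h_spin : ∀ i ∈ (Finset.univ : Finset (Fin n)), |spin (σ i)| ≤ 1 := by
    intro i _
    unfold spin
    split_ifs <;> simp
  simpa using Finset.sum_le_sum h_spin

theorem abs_mag_le_one (n : ℕ) (σ : Fin n → Bool) : |mag n σ| ≤ 1 := by
  unfold mag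
  rw [abs_div, Nat.abs_cast]
  exact div_le_one_of_le₀ (abs_magSum_le n σ) (Nat.cast_nonneg n)

theorem gibbsCW_mono (J h β : ℝ) (n : ℕ) (t R : ℝ) {A B : (Fin n → Bool) → ℝ}
    (hAB : ∀ σ, A σ ≤ B σ) : gibbsCW J h β n t R A ≤ gibbsCW J h β n t R B := by
  unfold gibbsCW
  have hZ := (partition_pos J h β n t R).le
  gcongr with σ
  exact hAB σ

theorem gibbsCW_const (J h β : ℝ) (n : ℕ) (t R c : ℝ) :
    gibbsCW J h β n t R (fun _ => c) = c := by
  unfold gibbsCW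
  rw [← Finset.mul_sum, mul_div_cancel_right₀ _ (partition_pos J h β n t R).ne']

theorem abs_gibbsCW_mag_le_one (J h β : ℝ) (n : ℕ) (t R : ℝ) :
    |gibbsCW J h β n t R (mag n)| ≤ 1 := by
  rw [abs_le]
  constructor
  · rw [← gibbsCW_const J h β n t R (-1)]
    exact gibbsCW_mono J h β n t R fun σ => (abs_le.1 (abs_mag_le_one n σ)).1
  · rw [← gibbsCW_const J h β n t R 1]
    exact gibbsCW_mono J h β n t R fun σ => (abs_le.1 (abs_mag_le_one n σ)).2

/-- The Gibbs variance is the second moment minus the squared mean. -/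
theorem gibbsCW_variance (J h β : ℝ) (n : ℕ) (t R : ℝ) (A : (Fin n → Bool) → ℝ) :
    gibbsCW J h β n t R (fun σ => (A σ - gibbsCW J h β n t R A) ^ 2) =
      gibbsCW J h β n t R (fun σ => A σ * A σ) - gibbsCW J h β n t R A ^ 2 := by
  have hZ := (partition_pos J h β n t R).ne'
  have h_mean : gibbsCW J h β n t R A * ∑ σ : Fin n → Bool, Real.exp (-(β * Hcw J h β n t R σ))
      = ∑ σ : Fin n → Bool, A σ * Real.exp (-(β * Hcw J h β n t R σ)) := by
    rw [gibbsCW, div_mul_cancel₀ _ hZ]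
  generalize gibbsCW J h β n t R A = m at h_mean ⊢
  have h_expand : ∑ σ : Fin n → Bool, (A σ - m) ^ 2 * Real.exp (-(β * Hcw J h β n t R σ))
      = ∑ σ : Fin n → Bool, A σ * A σ * Real.exp (-(β * Hcw J h β n t R σ))
        - 2 * m * ∑ σ : Fin n → Bool, A σ * Real.exp (-(β * Hcw J h β n t R σ))
        + m ^ 2 * ∑ σ : Fin n → Bool, Real.exp (-(β * Hcw J h β n t R σ)) := by
    rw [Finset.mul_sum, Finset.mul_sum, ← Finset.sum_sub_distrib, ← Finset.sum_add_distrib]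
    exact Finset.sum_congr rfl fun σ _ => by ring
  simp only [gibbsCW]
  rw [h_expand, ← h_mean]
  field_simp
  ring

theorem hasDerivAt_weight (J h : ℝ) {β : ℝ} (hβ : 0 < β) (n : ℕ) (t R : ℝ) (σ : Fin n → Bool) :
    HasDerivAt (fun r => Real.exp (-(β * Hcw J h β n t r σ)))
      (magSum n σ * Real.exp (-(β * Hcw J h β n t R σ))) R := by
  have h_exponent : HasDerivAt (fun r => -(β * Hcw J h β n t r σ)) (magSum n σ) R := by
    unfold Hcw
    refine (((((hasDerivAt_id R).div_const β).mul_const (magSum n σ)).const_sub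
      ((1 - t) * (-(J / n) * pairSum n σ - h * magSum n σ))).const_mul β).neg.congr_deriv ?_
    field_simp
  exact h_exponent.exp.congr_deriv (mul_comm _ _)

/-- The derivative of a Gibbs average in the effective field is a covariance with the spin sum. -/
theorem hasDerivAt_gibbsCW (J h : ℝ) {β : ℝ} (hβ : 0 < β) (n : ℕ) (t R : ℝ)
    (A : (Fin n → Bool) → ℝ) :
    HasDerivAt (fun r => gibbsCW J h β n t r A)
      (gibbsCW J h β n t R (fun σ => A σ * magSum n σ)
        - gibbsCW J h β n t R A * gibbsCW J h β n t R (magSum n)) R := by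
  have hZ := (partition_pos J h β n t R).ne'
  have h_num := HasDerivAt.fun_sum fun σ (_ : σ ∈ (Finset.univ : Finset (Fin n → Bool))) =>
    (hasDerivAt_weight J h hβ n t R σ).const_mul (A σ)
  have h_den := HasDerivAt.fun_sum fun σ (_ : σ ∈ (Finset.univ : Finset (Fin n → Bool))) =>
    hasDerivAt_weight J h hβ n t R σ
  refine (h_num.div h_den hZ).congr_deriv ?_
  simp only [gibbsCW, mul_assoc]
  field_simp

theorem continuous_gibbsCW (J h : ℝ) {β : ℝ} (hβ : 0 < β) (n : ℕ) (t : ℝ)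
    (A : (Fin n → Bool) → ℝ) : Continuous fun r => gibbsCW J h β n t r A :=
  continuous_iff_continuousAt.2 fun r => (hasDerivAt_gibbsCW J h hβ n t r A).continuousAt

theorem gibbsCW_const_mul (J h β : ℝ) (n : ℕ) (t R c : ℝ) (A : (Fin n → Bool) → ℝ) :
    gibbsCW J h β n t R (fun σ => c * A σ) = c * gibbsCW J h β n t R A := by
  simp only [gibbsCW, mul_assoc, ← Finset.mul_sum, mul_div_assoc]

/-- The susceptibility of the mean magnetization is `n` times its Gibbs variance. -/
theorem hasDerivAt_gibbsCW_mag (J h : ℝ) {β : ℝ} (hβ : 0 < β) {n : ℕ} (hn : 1 ≤ n) (t R : ℝ) :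
    HasDerivAt (fun r => gibbsCW J h β n t r (mag n))
      (n * gibbsCW J h β n t R (fun σ => (mag n σ - gibbsCW J h β n t R (mag n)) ^ 2)) R := by
  refine (hasDerivAt_gibbsCW J h hβ n t R (mag n)).congr_deriv ?_
  have h_magSum : magSum n = fun σ => (n : ℝ) * mag n σ := funext (magSum_eq_mul_mag hn)
  rw [gibbsCW_variance, h_magSum, gibbsCW_const_mul]
  simp only [mul_left_comm _ (n : ℝ)]
  rw [gibbsCW_const_mul]
  ring

/-- Concentration of the magnetization for the interpolating Curie-Weiss model:
if `ε ↦ R_ε(t)` is regular (a `C¹` diffeomorphism with Jacobian `∂_ε R_ε(t) ≥ 1` on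
`[s_n, 2s_n]`), then
`(1/s_n) ∫_{s_n}^{2s_n} dε ⟨(M - ⟨M⟩_{t,ε})²⟩_{t,ε} ≤ 2/(n s_n)`. -/
theorem curieWeiss_magnetization_concentration (J h β : ℝ) (hJ : 0 < J) (hβ : 0 < β)
    (n : ℕ) (hn : 1 ≤ n) (t : ℝ) (ht : t ∈ Set.Icc (0 : ℝ) 1)
    (sn : ℝ) (hsn : sn ∈ Set.Ioc (0 : ℝ) (1 / 2))
    (R R' : ℝ → ℝ)
    (hderiv : ∀ ε, HasDerivAt R (R' ε) ε)
    (hcont : Continuous R')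
    (hjac : ∀ ε ∈ Set.Icc sn (2 * sn), 1 ≤ R' ε) :
    (1 / sn) * ∫ ε in sn..(2 * sn),
        gibbsCW J h β n t (R ε)
          (fun σ => (mag n σ - gibbsCW J h β n t (R ε) (mag n)) ^ 2)
      ≤ 2 / (n * sn) := by
  obtain ⟨hs, -⟩ := hsn
  have hn_pos : (0 : ℝ) < n := by exact_mod_cast hn
  have hR : Continuous R := continuous_iff_continuousAt.2 fun ε => (hderiv ε).continuousAt
  set V : ℝ → ℝ := fun ε => gibbsCW J h β n t (R ε)
    (fun σ => (mag n σ - gibbsCW J h β n t (R ε) (mag n)) ^ 2) with hV_def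
  have hV_nonneg : ∀ ε, 0 ≤ V ε := fun ε => by
    rw [← gibbsCW_const J h β n t (R ε) 0]
    exact gibbsCW_mono J h β n t (R ε) fun σ => sq_nonneg _
  have hV_cont : Continuous V := by
    simp only [hV_def, gibbsCW_variance]
    exact ((continuous_gibbsCW J h hβ n t _).comp hR).sub
      (((continuous_gibbsCW J h hβ n t _).comp hR).pow 2)
  have h_cont_deriv : Continuous fun ε => n * V ε * R' ε := by fun_prop
  have h_ftc : ∫ ε in sn..(2 * sn), n * V ε * R' ε =
      gibbsCW J h β n t (R (2 * sn)) (mag n) - gibbsCW J h β n t (R sn) (mag n) :=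
    intervalIntegral.integral_eq_sub_of_hasDerivAt
      (f := fun ε => gibbsCW J h β n t (R ε) (mag n))
      (fun ε _ => (hasDerivAt_gibbsCW_mag J h hβ hn t (R ε)).comp ε (hderiv ε))
      (h_cont_deriv.intervalIntegrable _ _)
  have h_mono : ∫ ε in sn..(2 * sn), n * V ε ≤ ∫ ε in sn..(2 * sn), n * V ε * R' ε :=
    intervalIntegral.integral_mono_on (by linarith)
      ((hV_cont.const_mul _).intervalIntegrable _ _) (h_cont_deriv.intervalIntegrable _ _)
      fun ε hε => le_mul_of_one_le_right (mul_nonneg hn_pos.le (hV_nonneg ε)) (hjac ε hε)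
  rw [intervalIntegral.integral_const_mul] at h_mono
  have h_upper := (abs_le.1 (abs_gibbsCW_mag_le_one J h β n t (R (2 * sn)))).2
  have h_lower := (abs_le.1 (abs_gibbsCW_mag_le_one J h β n t (R sn))).1
  have h_bound : ∫ ε in sn..(2 * sn), V ε ≤ 2 / n := by
    rw [le_div_iff₀ hn_pos]
    linarith
  calc (1 / sn) * ∫ ε in sn..(2 * sn), V ε ≤ (1 / sn) * (2 / n) := by gcongr
    _ = 2 / (n * sn) := by field_simp
end

section
/- Let G and g be concave real-valued differentiable functions on an interval containing [x-δ, x+δ], where δ>0. Define C⁻_δ(x) = g'(x-δ) - g'(x) ≥ 0 and C⁺_δ(x) = g'(x) - g'(x+δ) ≥ 0. Then |G'(x) - g'(x)| ≤ δ^{-1} Σ_{u∈{x-δ, x, x+δ}} |G(u) - g(u)| + C⁺_δ(x) + C⁻_δ(x). -/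
/-- The increment of a differentiable concave function over `[y, y + δ]` lies between `δ` times
its derivatives at the two endpoints. -/
lemma ConcaveOn.mul_deriv_le_sub_le_mul_deriv {s : Set ℝ} {f : ℝ → ℝ} (hf : ConcaveOn ℝ s f)
    {y δ : ℝ} (hδ : 0 < δ) (hy : y ∈ s) (hz : y + δ ∈ s) (hfy : DifferentiableAt ℝ f y)
    (hfz : DifferentiableAt ℝ f (y + δ)) :
    δ * deriv f (y + δ) ≤ f (y + δ) - f y ∧ f (y + δ) - f y ≤ δ * deriv f y := by
  have hlt : y < y + δ := by linarith
  have hlower := hf.deriv_le_slope hy hz hlt hfz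
  have hupper := hf.slope_le_deriv hy hz hlt hfy
  rw [slope_def_field, add_sub_cancel_left] at hlower hupper
  exact ⟨(le_div_iff₀' hδ).mp hlower, (div_le_iff₀' hδ).mp hupper⟩

/-- Guerra-type comparison lemma for derivatives of concave functions: if `G` and `g`
are concave and differentiable on an (open) interval containing `[x-δ, x+δ]`, then
`|G'(x) - g'(x)| ≤ δ⁻¹ Σ_{u∈{x-δ,x,x+δ}} |G(u) - g(u)| + C⁺_δ(x) + C⁻_δ(x)`,
where `C⁻_δ(x) = g'(x-δ) - g'(x) ≥ 0` and `C⁺_δ(x) = g'(x) - g'(x+δ) ≥ 0`. -/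
theorem concave_deriv_comparison (a b x δ : ℝ) (hδ : 0 < δ) (G g : ℝ → ℝ)
    (hsub : Set.Icc (x - δ) (x + δ) ⊆ Set.Ioo a b)
    (hGconc : ConcaveOn ℝ (Set.Ioo a b) G)
    (hgconc : ConcaveOn ℝ (Set.Ioo a b) g)
    (hGdiff : ∀ y ∈ Set.Ioo a b, DifferentiableAt ℝ G y)
    (hgdiff : ∀ y ∈ Set.Ioo a b, DifferentiableAt ℝ g y) :
    |deriv G x - deriv g x|
      ≤ δ⁻¹ * (|G (x - δ) - g (x - δ)| + |G x - g x| + |G (x + δ) - g (x + δ)|)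
        + (deriv g x - deriv g (x + δ)) + (deriv g (x - δ) - deriv g x) := by
  have hl : x - δ ∈ Set.Ioo a b := hsub ⟨le_rfl, by linarith⟩
  have hm : x ∈ Set.Ioo a b := hsub ⟨by linarith, by linarith⟩
  have hr : x + δ ∈ Set.Ioo a b := hsub ⟨by linarith, le_rfl⟩
  have increments (f : ℝ → ℝ) (hf : ConcaveOn ℝ (Set.Ioo a b) f)
      (hd : ∀ y ∈ Set.Ioo a b, DifferentiableAt ℝ f y) :
      (δ * deriv f x ≤ f x - f (x - δ) ∧ f x - f (x - δ) ≤ δ * deriv f (x - δ)) ∧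
        (δ * deriv f (x + δ) ≤ f (x + δ) - f x ∧ f (x + δ) - f x ≤ δ * deriv f x) := by
    have hleft := hf.mul_deriv_le_sub_le_mul_deriv hδ hl (by simpa using hm) (hd _ hl)
      (by simpa using hd x hm)
    rw [sub_add_cancel] at hleft
    exact ⟨hleft, hf.mul_deriv_le_sub_le_mul_deriv hδ hm hr (hd x hm) (hd _ hr)⟩
  obtain ⟨⟨hG₁, -⟩, -, hG₂⟩ := increments G hGconc hGdiff
  obtain ⟨⟨hg₁, hg₂⟩, hg₃, hg₄⟩ := increments g hgconc hgdiff
  obtain ⟨hl₁, hl₂⟩ := abs_le.mp (le_refl |G (x - δ) - g (x - δ)|)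
  obtain ⟨hm₁, hm₂⟩ := abs_le.mp (le_refl |G x - g x|)
  obtain ⟨hr₁, hr₂⟩ := abs_le.mp (le_refl |G (x + δ) - g (x + δ)|)
  have hscale : δ * |deriv G x - deriv g x| = |δ * (deriv G x - deriv g x)| := by
    rw [abs_mul, abs_of_pos hδ]
  refine le_of_mul_le_mul_left ?_ hδ
  rw [hscale, mul_add, mul_add, mul_inv_cancel_left₀ hδ.ne']
  exact abs_le.mpr ⟨by linarith, by linarith⟩
end
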